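/- (Multi-Level Self-Complementary ROSS, parts b and c) Let {g_i, h_i}_{i∈{0,1}} be a perfect reconstruction filterbank with finitely supported filters that satisfies the analysis–synthesis symmetry with parameters (a,b) and is self-complementary. Then for every number of levels L ≥ 1, every bit vector 𝐢 ∈ {0,1}^L, every x : ℤ → ℝ, and every n ∈ ℤ: v^{x_m}_𝐢[n] = v^x_{𝐢′}[n] and v^{x_s}_𝐢[n] = (1/2)·(v^x_𝐢[n] + v^x_{𝐢′}[n]). -/

import Mathlib

open scoped BigOperators

noncomputable section

/-- Discrete convolution `(f ⋆ x)[n] = Σ_m f[m]·x[n−m]` (a finite sum when `f` is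
finitely supported). -/
def conv (f x : ℤ → ℝ) (n : ℤ) : ℝ := ∑ᶠ m : ℤ, f m * x (n - m)

/-- One-level filterbank coefficient `v^x_i[n] = (g_i ⋆ x)[2n]`. -/
def fbCoeff (g x : ℤ → ℝ) (n : ℤ) : ℝ := conv g x (2 * n)

/-- Perfect reconstruction filterbank:
`x[n] = Σ_{i∈{0,1}} Σ_m h_i[n−2m]·v^x_i[m]` for all `x` and `n`. -/
def IsPR (g h : ZMod 2 → ℤ → ℝ) : Prop :=
  ∀ (x : ℤ → ℝ) (n : ℤ),
    x n = ∑ i : ZMod 2, ∑ᶠ m : ℤ, h i (n - 2 * m) * fbCoeff (g i) x m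

/-- Discrete-time Fourier transform `f̂(ω) = Σ_n f[n]·exp(−i·n·ω)`. -/
def dtft (f : ℤ → ℝ) (ω : ℝ) : ℂ :=
  ∑ᶠ n : ℤ, (f n : ℂ) * Complex.exp (-(Complex.I * (n : ℂ) * (ω : ℂ)))

/-- Analysis–synthesis symmetry with parameters `(a, b)`:
`ĝ_i(ω) = (−1)^{1−i}·a·exp(i(2b+1)ω)·ĥ_{1−i}(ω−π)`. -/
def SymmAS (g h : ZMod 2 → ℤ → ℝ) (a : ℝ) (b : ℤ) : Prop :=
  ∀ (i : ZMod 2) (ω : ℝ),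
    dtft (g i) ω
      = (-1 : ℂ) ^ (1 - i : ZMod 2).val * (a : ℂ)
        * Complex.exp (Complex.I * (2 * (b : ℂ) + 1) * (ω : ℂ))
        * dtft (h (1 - i)) (ω - Real.pi)

/-- Complementary analysis filter `g̃_i[n] = a·h_i[n + 2b + 1]`. -/
def compG (a : ℝ) (b : ℤ) (h : ℤ → ℝ) (n : ℤ) : ℝ := a * h (n + (2 * b + 1))

/-- Complementary synthesis filter `h̃_i[n] = a⁻¹·g_i[n − (2b + 1)]`. -/
def compH (a : ℝ) (b : ℤ) (g : ℤ → ℝ) (n : ℤ) : ℝ := a⁻¹ * g (n - (2 * b + 1))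

/-- Modulated sequence `x_m[n] = (−1)^n·x[n]`. -/
def modSeq (x : ℤ → ℝ) (n : ℤ) : ℝ := (-1 : ℝ) ^ n * x n

/-- Subsampled sequence: `x_s[n] = x[n]` for even `n`, and `0` for odd `n`. -/
def subSeq (x : ℤ → ℝ) (n : ℤ) : ℝ := if Even n then x n else 0

/-- Haar analysis filters: `g_i[0] = 1`, `g_i[−1] = (−1)^i`, else `0`. -/
def haarG (i : ZMod 2) (n : ℤ) : ℝ :=
  if n = 0 then 1 else if n = -1 then (-1 : ℝ) ^ i.val else 0

/-- Haar synthesis filters: `h_i[0] = 1/2`, `h_i[1] = (−1)^i/2`, else `0`. -/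
def haarH (i : ZMod 2) (n : ℤ) : ℝ :=
  if n = 0 then 1 / 2 else if n = 1 then (-1 : ℝ) ^ i.val / 2 else 0

/-- `L`-level filterbank coefficients `v^x_𝐢`; the bit `𝐢 0` is the level-0 bit,
applied first, then the remaining levels recursively. -/
def mCoeff (g : ZMod 2 → ℤ → ℝ) : (L : ℕ) → (Fin L → ZMod 2) → (ℤ → ℝ) → ℤ → ℝ
  | 0, _, x => x
  | L + 1, i, x => mCoeff g L (fun t => i t.succ) (fbCoeff (g (i 0)) x)

/-- `L`-level complementary coefficients `w^x_𝐢`: identical to `mCoeff` except that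
the level-0 filter is taken from the complementary bank `gt`. -/
def mCoeffW (g gt : ZMod 2 → ℤ → ℝ) : (L : ℕ) → (Fin L → ZMod 2) → (ℤ → ℝ) → ℤ → ℝ
  | 0, _, x => x
  | L + 1, i, x => mCoeff g L (fun t => i t.succ) (fbCoeff (gt (i 0)) x)

/-- `𝐢′`: flip the level-0 bit of `𝐢`. -/
def flip0 {L : ℕ} (i : Fin (L + 1) → ZMod 2) : Fin (L + 1) → ZMod 2 :=
  Function.update i 0 (1 - i 0)

/-- The character `ω ↦ exp(−i·n·ω)` of the additive group of the reals. -/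
def expChar (n : ℤ) : Multiplicative ℝ →* ℂ where
  toFun ω := Complex.exp (-(Complex.I * (n : ℂ) * ((Multiplicative.toAdd ω : ℝ) : ℂ)))
  map_one' := by simp
  map_mul' ω η := by
    rw [← Complex.exp_add, toAdd_mul]
    congr 1
    push_cast
    ring

theorem expChar_injective : Function.Injective expChar := by
  intro n m hnm
  by_contra hne
  have hd : (n : ℂ) - m ≠ 0 := sub_ne_zero.2 (by exact_mod_cast hne)
  have key := DFunLike.congr_fun hnm (Multiplicative.ofAdd (Real.pi / ((n : ℝ) - m)))
  simp only [expChar, MonoidHom.coe_mk, OneHom.coe_mk, toAdd_ofAdd] at key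
  have hsplit : -(Complex.I * (m : ℂ) * ((Real.pi / ((n : ℝ) - m) : ℝ) : ℂ))
      = -(Complex.I * (n : ℂ) * ((Real.pi / ((n : ℝ) - m) : ℝ) : ℂ)) + Real.pi * Complex.I := by
    push_cast
    field_simp
    ring
  rw [hsplit, Complex.exp_add, Complex.exp_pi_mul_I] at key
  have h0 := Complex.exp_ne_zero (-(Complex.I * (n : ℂ) * ((Real.pi / ((n : ℝ) - m) : ℝ) : ℂ)))
  exact h0 (by linear_combination key / 2)

/-- The discrete-time Fourier transform is injective on finitely supported sequences. -/
theorem dtft_injective {f k : ℤ → ℝ} (hf : f.support.Finite) (hk : k.support.Finite)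
    (hfk : ∀ ω, dtft f ω = dtft k ω) : f = k := by
  have hli : LinearIndependent ℂ (fun n : ℤ => (expChar n : Multiplicative ℝ → ℂ)) :=
    (linearIndependent_monoidHom (Multiplicative ℝ) ℂ).comp expChar expChar_injective
  set s : Finset ℤ := hf.toFinset ∪ hk.toFinset with hs
  have hsum : ∀ u : ℤ → ℝ, (∀ n, u n ≠ 0 → n ∈ s) → ∀ ω,
      dtft u ω = ∑ n ∈ s, (u n : ℂ) * Complex.exp (-(Complex.I * (n : ℂ) * (ω : ℂ))) := by
    intro u hu ω
    refine finsum_eq_sum_of_support_subset _ fun n hn => hu n fun h0 => hn ?_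
    simp [h0]
  have hfs : ∀ n, f n ≠ 0 → n ∈ s := fun n hn => by simp [hs, hn]
  have hks : ∀ n, k n ≠ 0 → n ∈ s := fun n hn => by simp [hs, hn]
  have hzero := linearIndependent_iff'.1 hli s (fun n => ((f n : ℂ) - k n)) (by
    funext ω
    have h1 := hfk (Multiplicative.toAdd ω)
    rw [hsum f hfs, hsum k hks, ← sub_eq_zero, ← Finset.sum_sub_distrib] at h1
    simpa [Finset.sum_apply, expChar, sub_mul] using h1)
  funext n
  by_cases hn : n ∈ s
  · exact_mod_cast sub_eq_zero.1 (hzero n hn)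
  · rw [not_imp_comm.1 (hfs n) hn, not_imp_comm.1 (hks n) hn]

/-- Time-domain form of shifting, modulating and scaling in frequency. -/
theorem dtft_scale_shift_mod (c : ℝ) (d : ℤ) (f : ℤ → ℝ) (ω : ℝ) :
    dtft (fun n => c * ((-1 : ℝ) ^ (n + d) * f (n + d))) ω
      = c * Complex.exp (Complex.I * d * ω) * dtft f (ω - Real.pi) := by
  have hneg : ∀ n : ℤ, Complex.exp (Complex.I * n * Real.pi) = (-1 : ℂ) ^ n := fun n => by
    rw [← Complex.exp_pi_mul_I, ← Complex.exp_int_mul]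
    congr 1
    ring
  unfold dtft
  rw [← smul_eq_mul, smul_finsum]
  conv_rhs => rw [← finsum_comp_equiv (Equiv.addRight d)]
  refine finsum_congr fun n => ?_
  have hexp : Complex.exp (-(Complex.I * ((n + d : ℤ) : ℂ) * ((ω - Real.pi : ℝ) : ℂ)))
      = Complex.exp (-(Complex.I * n * ω)) * (Complex.exp (Complex.I * d * ω))⁻¹
        * (-1 : ℂ) ^ (n + d) := by
    rw [← hneg, ← Complex.exp_neg, ← Complex.exp_add, ← Complex.exp_add]
    congr 1
    push_cast
    ring
  have h0 := Complex.exp_ne_zero (Complex.I * d * ω)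
  simp only [Equiv.coe_addRight, smul_eq_mul]
  rw [hexp]
  push_cast
  field_simp

theorem analysis_eq_of_symmAS {g h : ZMod 2 → ℤ → ℝ}
    (hg : ∀ i, (Function.support (g i)).Finite) (hh : ∀ i, (Function.support (h i)).Finite)
    {a : ℝ} {b : ℤ} (hsym : SymmAS g h a b) (i : ZMod 2) (n : ℤ) :
    g i n = (-1 : ℝ) ^ (1 - i : ZMod 2).val * a
      * ((-1 : ℝ) ^ (n + (2 * b + 1)) * h (1 - i) (n + (2 * b + 1))) := by
  have hfin : (Function.support fun n : ℤ => (-1 : ℝ) ^ (1 - i : ZMod 2).val * a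
      * ((-1 : ℝ) ^ (n + (2 * b + 1)) * h (1 - i) (n + (2 * b + 1)))).Finite := by
    refine ((hh (1 - i)).preimage
      (f := fun n : ℤ => n + (2 * b + 1)) (add_left_injective _).injOn).subset fun n hn h0 => ?_
    exact hn (by simp [h0])
  refine congrFun (dtft_injective (hg i) hfin fun ω => ?_) n
  rw [dtft_scale_shift_mod, hsym i ω]
  push_cast
  rfl

theorem fbCoeff_single (f : ℤ → ℝ) (m : ℤ) : fbCoeff f (Pi.single (-m) 1) 0 = f m := by
  rw [fbCoeff, conv, finsum_eq_single _ m]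
  · simp
  · intro k hk
    rw [Pi.single_eq_of_ne (by omega), mul_zero]

/-- In a self-complementary filterbank the analysis filters are modulations of each other. -/
theorem analysis_eq_mod_of_selfcomp {g h : ZMod 2 → ℤ → ℝ}
    (hg : ∀ i, (Function.support (g i)).Finite) (hh : ∀ i, (Function.support (h i)).Finite)
    {a : ℝ} {b : ℤ} (hsym : SymmAS g h a b)
    (hsc : ∀ (x : ℤ → ℝ) (i : ZMod 2) (n : ℤ),
      fbCoeff (g i) x n
        = (-1 : ℝ) ^ (1 - i : ZMod 2).val * fbCoeff (compG a b (h i)) x n)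
    (i : ZMod 2) (n : ℤ) : (-1 : ℝ) ^ n * g i n = g (1 - i) n := by
  have h1 := analysis_eq_of_symmAS hg hh hsym i n
  have h2 := hsc (Pi.single (-n) 1) (1 - i) 0
  rw [fbCoeff_single, fbCoeff_single, compG] at h2
  have hpow : (-1 : ℝ) ^ (n + (2 * b + 1)) = -(-1 : ℝ) ^ n := by
    rw [zpow_add₀ (by norm_num), zpow_add₀ (by norm_num), zpow_mul]
    norm_num
  have hsq : (-1 : ℝ) ^ n * (-1 : ℝ) ^ n = 1 := by
    rw [← mul_zpow]
    norm_num
  have hsign : (-1 : ℝ) ^ (1 - (1 - i) : ZMod 2).val = -(-1 : ℝ) ^ (1 - i : ZMod 2).val := by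
    have hval : ∀ j : ZMod 2, ((1 - (1 - j)).val = 0 ∧ (1 - j).val = 1)
        ∨ ((1 - (1 - j)).val = 1 ∧ (1 - j).val = 0) := by decide
    rcases hval i with ⟨hl, hr⟩ | ⟨hl, hr⟩ <;> rw [hl, hr] <;> norm_num
  rw [h2, h1, hpow, hsign]
  linear_combination (-((-1 : ℝ) ^ (1 - i : ZMod 2).val * a * h (1 - i) (n + (2 * b + 1)))) * hsq

theorem fbCoeff_smul_add {f : ℤ → ℝ} (hf : f.support.Finite) (c : ℝ) (x y : ℤ → ℝ) :
    fbCoeff f (c • (x + y)) = c • (fbCoeff f x + fbCoeff f y) := by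
  funext n
  have hfin : ∀ z : ℤ → ℝ, (Function.support fun m => f m * z (2 * n - m)).Finite := fun z =>
    hf.subset (Function.support_mul_subset_left _ _)
  simp only [fbCoeff, conv, Pi.smul_apply, Pi.add_apply]
  rw [← finsum_add_distrib (hfin x) (hfin y), smul_finsum]
  exact finsum_congr fun m => by simp only [smul_eq_mul]; ring

theorem mCoeff_smul_add {g : ZMod 2 → ℤ → ℝ} (hg : ∀ i, (Function.support (g i)).Finite)
    (c : ℝ) (L : ℕ) (i : Fin L → ZMod 2) (x y : ℤ → ℝ) :
    mCoeff g L i (c • (x + y)) = c • (mCoeff g L i x + mCoeff g L i y) := by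
  induction L generalizing x y with
  | zero => rfl
  | succ L ih => simp only [mCoeff, fbCoeff_smul_add (hg _), ih]

theorem subSeq_eq (x : ℤ → ℝ) : subSeq x = (1 / 2 : ℝ) • (x + modSeq x) := by
  funext n
  by_cases hn : Even n
  · simp only [subSeq, modSeq, hn, if_true, hn.neg_one_zpow, Pi.smul_apply, Pi.add_apply,
      smul_eq_mul]
    ring
  · simp [subSeq, modSeq, hn, (Int.not_even_iff_odd.1 hn).neg_one_zpow]

theorem fbCoeff_modSeq (f x : ℤ → ℝ) :
    fbCoeff f (modSeq x) = fbCoeff (modSeq f) x := by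
  funext n
  refine finsum_congr fun m => ?_
  have hpow : (-1 : ℝ) ^ (2 * n - m) = (-1 : ℝ) ^ m := by
    rw [zpow_sub₀ (by norm_num), zpow_mul]
    rcases Int.even_or_odd m with hm | hm <;> simp [hm.neg_one_zpow]
  simp only [modSeq, hpow]
  ring

/-- Multi-level self-complementary ROSS (parts b and c). -/
theorem multilevel_selfcomp_ROSS_bc (g h : ZMod 2 → ℤ → ℝ)
    (hg : ∀ i : ZMod 2, (Function.support (g i)).Finite)
    (hh : ∀ i : ZMod 2, (Function.support (h i)).Finite)
    (a : ℝ) (b : ℤ) (ha : a ≠ 0)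
    (hPR : IsPR g h) (hsym : SymmAS g h a b)
    (hsc : ∀ (x : ℤ → ℝ) (i : ZMod 2) (n : ℤ),
      fbCoeff (g i) x n
        = (-1 : ℝ) ^ (1 - i : ZMod 2).val * fbCoeff (compG a b (h i)) x n)
    (L : ℕ) (i : Fin (L + 1) → ZMod 2) (x : ℤ → ℝ) (n : ℤ) :
    mCoeff g (L + 1) i (modSeq x) n = mCoeff g (L + 1) (flip0 i) x n ∧
    mCoeff g (L + 1) i (subSeq x) n
      = (1 / 2) * (mCoeff g (L + 1) i x n + mCoeff g (L + 1) (flip0 i) x n) := by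
  have hmod : mCoeff g (L + 1) i (modSeq x) = mCoeff g (L + 1) (flip0 i) x := by
    have hfilter : modSeq (g (i 0)) = g (1 - i 0) :=
      funext fun n => analysis_eq_mod_of_selfcomp hg hh hsym hsc (i 0) n
    simp [mCoeff, flip0, fbCoeff_modSeq, hfilter]
  refine ⟨congrFun hmod n, ?_⟩
  rw [subSeq_eq, mCoeff_smul_add hg, hmod]
  rfl
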